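/- arXiv:1107.4422 — 5 statements merged into one kernel-verified Lean document; each statement's English description precedes it below -/
import Mathlib

section
/- Return-value determination by a covering basis (the core of the paper's Lemma 6.3): let Σ and α be types, ret : Σ → α a function, and S a set of predicates on Σ such that for every c : α the predicate (fun σ => ret σ = c) is a positive boolean combination over S. Then for all states σ, σ' : Σ with TS_S(σ') ⊆ TS_S(σ), ret σ = ret σ'. -/
/-- A positive boolean combination over a set `S` of predicates on `St`:
built from members of `S` by finitely many pointwise conjunctions and disjunctions. -/
inductive PosComb {St : Type*} (S : Set (St → Prop)) : (St → Prop) → Prop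
  | base {p : St → Prop} : p ∈ S → PosComb S p
  | and {p q : St → Prop} : PosComb S p → PosComb S q → PosComb S (fun σ => p σ ∧ q σ)
  | or {p q : St → Prop} : PosComb S p → PosComb S q → PosComb S (fun σ => p σ ∨ q σ)

/-- The set of predicates in `S` that hold at state `σ`. -/
def TS {St : Type*} (S : Set (St → Prop)) (σ : St) : Set (St → Prop) :=
  {p ∈ S | p σ}

/-- Positive boolean combinations are monotone in the set of basis predicates that hold. -/
theorem PosComb.mono {St : Type*} {S : Set (St → Prop)} {p : St → Prop} (hp : PosComb S p)
    {σ σ' : St} (h : TS S σ' ⊆ TS S σ) (hσ' : p σ') : p σ := by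
  induction hp with
  | base hmem => exact (h ⟨hmem, hσ'⟩).2
  | and _ _ ihp ihq => exact ⟨ihp hσ'.1, ihq hσ'.2⟩
  | or _ _ ihp ihq => exact hσ'.imp ihp ihq

/-- Return-value determination by a covering basis: if for every `c` the predicate
`ret σ = c` is a positive boolean combination over `S`, then `TS S σ' ⊆ TS S σ`
implies `ret σ = ret σ'`. -/
theorem ret_determined {St α : Type*} (ret : St → α) (S : Set (St → Prop))
    (hcov : ∀ c : α, PosComb S (fun σ => ret σ = c)) :
    ∀ σ σ' : St, TS S σ' ⊆ TS S σ → ret σ = ret σ' := by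
  intro σ σ' h
  exact (hcov (ret σ')).mono h rfl
end

section
/- Snapshot correctness for two-state assertions (part (3) of the paper's Lemma 4.1, in concrete form): let Σ be a type and let (x₀,y₀), (x₁,y₁), …, (xₙ,yₙ) be a sequence in Σ × Σ, and let E ⊆ {1,…,n} be a set of entry-step indices such that: for every i ∈ E, xᵢ = xᵢ₋₁ and yᵢ = xᵢ₋₁ (the entry step leaves the state unchanged and snapshots it), and for every i ∈ {1,…,n} \ E, yᵢ = yᵢ₋₁ (all other steps leave the snapshot unchanged). Then for every index j such that E ∩ {1,…,j} is nonempty, yⱼ = x_{m-1} where m is the largest element of E ∩ {1,…,j}; consequently, for every two-state assertion Φ : Σ → Σ → Prop, the one-state assertion Φ̃ (x,y) := Φ y x holds at (xⱼ,yⱼ) if and only if Φ holds of the pair (state at the most recent entry step, xⱼ). -/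
/-- Snapshot correctness for two-state assertions: if entry steps (indices in `E`)
leave the state unchanged and snapshot it, and all other steps leave the snapshot
unchanged, then at any index `j` the snapshot component equals the state just before
the most recent entry step `m`; hence any two-state assertion `Φ` holds of
(state at the most recent entry step, current state) iff the corresponding one-state
assertion `fun (x, y) => Φ y x` holds of the augmented state. -/
theorem snapshot_correct {St : Type*} (n : ℕ) (x y : ℕ → St) (E : Set ℕ)
    (hE : E ⊆ Set.Icc 1 n)
    (hentry : ∀ i ∈ E, x i = x (i - 1) ∧ y i = x (i - 1))
    (hother : ∀ i ∈ Set.Icc 1 n, i ∉ E → y i = y (i - 1)) :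
    ∀ j ≤ n, ∀ m : ℕ, IsGreatest (E ∩ Set.Icc 1 j) m →
      y j = x (m - 1) ∧
      ∀ Φ : St → St → Prop,
        ((fun p : St × St => Φ p.2 p.1) (x j, y j) ↔ Φ (x (m - 1)) (x j)) := by
  rintro j hj m ⟨⟨hmE, hm1, hmj⟩, hmax⟩
  have snapshot_const : ∀ k, m ≤ k → k ≤ j → y k = y m := by
    intro k hmk
    induction k, hmk using Nat.le_induction with
    | base => exact fun _ => rfl
    | succ k hmk ih =>
      intro hkj
      have hnot : k + 1 ∉ E := fun hk => by
        have : k + 1 ≤ m := hmax ⟨hk, by omega, hkj⟩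
        omega
      rw [hother (k + 1) ⟨by omega, by omega⟩ hnot]
      exact ih (by omega)
  have hy : y j = x (m - 1) := (snapshot_const j hmj le_rfl).trans (hentry m hmE).2
  exact ⟨hy, fun Φ => by simp only [hy]⟩
end

section
/- Monotone propagation through a wp-closed step (the paper's Lemma 6.1, with deterministic edge semantics): let Σ be a type, f : Σ → Σ a step function, and B, B' sets of predicates on Σ such that for every φ ∈ B', the predicate φ ∘ f is a positive boolean combination over B. Then for all states σ₁, σ₃ : Σ, if TS_B(σ₃) ⊆ TS_B(σ₁), then TS_{B'}(f σ₃) ⊆ TS_{B'}(f σ₁). -/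
/-- A positive boolean combination over `S` is preserved when passing to a state that
satisfies at least the same members of `S`. -/
theorem PosComb.of_TS_subset {St : Type*} {S : Set (St → Prop)} {p : St → Prop}
    (hp : PosComb S p) {σ τ : St} (h : TS S σ ⊆ TS S τ) : p σ → p τ := by
  induction hp with
  | base hmem => exact fun hσ => (h ⟨hmem, hσ⟩).2
  | and _ _ ihp ihq => exact And.imp ihp ihq
  | or _ _ ihp ihq => exact Or.imp ihp ihq

/-- Monotone propagation through a wp-closed step: if for every `φ ∈ B'`, `φ ∘ f` is a
positive boolean combination over `B`, then `TS B σ₃ ⊆ TS B σ₁` implies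
`TS B' (f σ₃) ⊆ TS B' (f σ₁)`. -/
theorem wp_closed_monotone {St : Type*} (f : St → St)
    (B B' : Set (St → Prop))
    (hwp : ∀ φ ∈ B', PosComb B (fun σ => φ (f σ))) :
    ∀ σ₁ σ₃ : St, TS B σ₃ ⊆ TS B σ₁ → TS B' (f σ₃) ⊆ TS B' (f σ₁) := by
  intro σ₁ σ₃ h φ hφ
  exact ⟨hφ.1, (hwp φ hφ.1).of_TS_subset h hφ.2⟩
end

section
/- The inductive step of the paper's Lemma 6.2: let Σ be a type, f : Σ → Σ a deterministic step function, g : Σ → Prop a branch guard, and B, B' sets of predicates on Σ such that: g and its pointwise negation are both positive boolean combinations over B (the basis covers the branch condition), and for every φ ∈ B', φ ∘ f is a positive boolean combination over B (wp-closedness). Then for all states σ, σ' : Σ with TS_B(σ') ⊆ TS_B(σ) and g σ, it holds that g σ' (the step is also enabled at σ') and TS_{B'}(f σ') ⊆ TS_{B'}(f σ). -/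
/-- Positive boolean combinations are monotone with respect to inclusion of `TS`. -/
theorem PosComb.mono_of_TS_subset {St : Type*} {S : Set (St → Prop)} {φ : St → Prop}
    (hφ : PosComb S φ) {σ σ' : St} (h : TS S σ' ⊆ TS S σ) : φ σ' → φ σ := by
  induction hφ with
  | base hp => exact fun hσ' => (h ⟨hp, hσ'⟩).2
  | and _ _ ihp ihq => exact And.imp ihp ihq
  | or _ _ ihp ihq => exact Or.imp ihp ihq

/-- The inductive step of Lemma 6.2: with the branch guard and its negation positively
covered by `B` and wp-closedness of `B'` along `f`, `TS B σ' ⊆ TS B σ` and `g σ` give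
`g σ'` and `TS B' (f σ') ⊆ TS B' (f σ)`. -/
theorem guard_covered_step {St : Type*} (f : St → St) (g : St → Prop)
    (B B' : Set (St → Prop))
    (hg : PosComb B g) (hgneg : PosComb B (fun σ => ¬ g σ))
    (hwp : ∀ φ ∈ B', PosComb B (fun σ => φ (f σ))) :
    ∀ σ σ' : St, TS B σ' ⊆ TS B σ → g σ →
      g σ' ∧ TS B' (f σ') ⊆ TS B' (f σ) := by
  intro σ σ' h hσ
  refine ⟨?_, fun φ hφ => ⟨hφ.1, (hwp φ hφ.1).mono_of_TS_subset h hφ.2⟩⟩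
  by_contra hσ'
  exact hgneg.mono_of_TS_subset h hσ' hσ
end

section
/- Feasibility of the solo run under interference-freedom (per-thread form of the paper's Lemma 6.2): let Σ be a type, n a natural number, and for each i < n let fᵢ : Σ → Σ be a step function and gᵢ : Σ → Prop a guard; let B₀, …, Bₙ be sets of predicates on Σ such that for each i < n: gᵢ and its pointwise negation are positive boolean combinations over Bᵢ, and for every φ ∈ Bᵢ₊₁, φ ∘ fᵢ is a positive boolean combination over Bᵢ. Let τ₀, …, τₙ (the thread's views along an interleaved execution) and ρ₀, …, ρₙ (the serial execution) be states satisfying: TS_{B₀}(ρ₀) ⊆ TS_{B₀}(τ₀); for each i < n, gᵢ τᵢ holds and TS_{B_{i+1}}(fᵢ τᵢ) ⊆ TS_{B_{i+1}}(τᵢ₊₁) (interference between the thread's steps only preserves its true basis predicates); and ρᵢ₊₁ = fᵢ ρᵢ. Then for every i ≤ n, TS_{Bᵢ}(ρᵢ) ⊆ TS_{Bᵢ}(τᵢ), and for every i < n, gᵢ ρᵢ holds, i.e., the serial (uninterfered) run is feasible and takes the same execution path. -/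
/-- Positive boolean combinations over `S` are monotone in the set of true predicates. -/
theorem PosComb.holds_of_TS_subset {St : Type*} {S : Set (St → Prop)} {φ : St → Prop}
    (hφ : PosComb S φ) {σ σ' : St} (h : TS S σ ⊆ TS S σ') : φ σ → φ σ' := by
  induction hφ with
  | base hp => exact fun hσ => (h ⟨hp, hσ⟩).2
  | and _ _ ihp ihq => exact And.imp ihp ihq
  | or _ _ ihp ihq => exact Or.imp ihp ihq

/-- Feasibility of the solo run under interference-freedom: given a closed basis chain
`B 0, …, B n` along the thread's path (guards and their negations positively covered,
wp-closedness), interleaved views `τ` in which interference only preserves the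
thread's true basis predicates, and the serial run `ρ` with `ρ (i+1) = f i (ρ i)`,
the serial run satisfies `TS (B i) (ρ i) ⊆ TS (B i) (τ i)` for all `i ≤ n` and every
guard `g i (ρ i)` holds, i.e. the serial run is feasible along the same path. -/
theorem solo_run_feasible {St : Type*} (n : ℕ)
    (f : ℕ → St → St) (g : ℕ → St → Prop)
    (B : ℕ → Set (St → Prop)) (τ ρ : ℕ → St)
    (hg : ∀ i < n, PosComb (B i) (g i) ∧ PosComb (B i) (fun σ => ¬ g i σ))
    (hwp : ∀ i < n, ∀ φ ∈ B (i + 1), PosComb (B i) (fun σ => φ (f i σ)))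
    (h0 : TS (B 0) (ρ 0) ⊆ TS (B 0) (τ 0))
    (hτ : ∀ i < n, g i (τ i) ∧
      TS (B (i + 1)) (f i (τ i)) ⊆ TS (B (i + 1)) (τ (i + 1)))
    (hρ : ∀ i < n, ρ (i + 1) = f i (ρ i)) :
    (∀ i ≤ n, TS (B i) (ρ i) ⊆ TS (B i) (τ i)) ∧ (∀ i < n, g i (ρ i)) := by
  have hsub : ∀ i ≤ n, TS (B i) (ρ i) ⊆ TS (B i) (τ i) := by
    intro i
    induction i with
    | zero => exact fun _ => h0
    | succ i ih =>
      rintro hi φ ⟨hφ, hφρ⟩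
      rw [hρ i hi] at hφρ
      exact (hτ i hi).2 ⟨hφ, (hwp i hi φ hφ).holds_of_TS_subset (ih (Nat.le_of_succ_le hi)) hφρ⟩
  refine ⟨hsub, fun i hi => ?_⟩
  by_contra hn
  exact (hg i hi).2.holds_of_TS_subset (hsub i hi.le) hn (hτ i hi).1
end
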